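/- There exists a universal constant C > 0 such that the following holds (Case III). Let n ≥ 3, t > 0, r ∈ [0,∞), p ∈ [1,3/2) with p < 3/2 − 2r (so necessarily 0 ≤ r < 1/4), and let X be a random vector in ℝ^n with the standard normal distribution. Then: (i) for every x ∈ ℝ^n, ∑_{i=1}^{n} i^{-2r}·x_[i]^{2(p-1)} ≤ C·n^{(1-2r)(3-2p)}·(∑_{i=1}^{n} i^{-2r}·x_[i])^{2(p-1)}; (ii) with probability at least 1 − C·exp(−t²/2), ∑_{i=1}^{n} i^{-2r}·X_[i] ≤ C·n^{1-2r} + C·n^{(1-4r)/2}·(ln n/(1 + (1-4r)·ln n))^{1/2}·t, and consequently ∑_{i=1}^{n} i^{-2r}·X_[i]^{2(p-1)} ≤ C·n^{1-2r} + C·n^{2-2r-p}·(ln n/(1 + (1-4r)·ln n))^{p-1}·t^{2(p-1)}. -/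

import Mathlib

open MeasureTheory ProbabilityTheory

/-- `decRe x` is the non-increasing rearrangement of `(|x_1|, …, |x_n|)`
(indexed from `0`, so `decRe x i = x_[i+1]` in the paper's notation). -/
noncomputable def decRe {n : ℕ} (x : Fin n → ℝ) : Fin n → ℝ :=
  fun i => |x (Tuple.sort (fun j => |x j|) i.rev)|

/-- The standard Gaussian measure `N(0, I_n)` on `ℝ^n`. -/
noncomputable def stdGaussian (n : ℕ) : Measure (Fin n → ℝ) :=
  Measure.pi fun _ => gaussianReal 0 1

section GaussianConcentration

instance isProbabilityMeasure_stdGaussian_fin (n : ℕ) :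
    IsProbabilityMeasure (_root_.stdGaussian n) := by
  unfold _root_.stdGaussian; infer_instance

lemma isGaussian_stdGaussian_fin (n : ℕ) : IsGaussian (_root_.stdGaussian n) := by
  have h := iIndepFun.hasGaussianLaw
    (P := Measure.pi fun _ : Fin n => gaussianReal 0 1) (X := fun i (x : Fin n → ℝ) => x i)
    (fun i => ⟨by
      rw [show (fun x : Fin n → ℝ => x i) = Function.eval i from rfl,
        (measurePreserving_eval (fun _ : Fin n => gaussianReal 0 1) i).map_eq]
      infer_instance⟩)
    (iIndepFun_pi (X := fun _ (x : ℝ) => x) fun _ => aemeasurable_id)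
  simpa [_root_.stdGaussian] using h.isGaussian_map

lemma integral_comp_eval_stdGaussian {n : ℕ} (i : Fin n) {f : ℝ → ℝ} (hf : Measurable f) :
    ∫ x, f (x i) ∂(_root_.stdGaussian n) = ∫ y, f y ∂(gaussianReal 0 1) :=
  integral_comp_eval (μ := fun _ : Fin n => gaussianReal 0 1) hf.aestronglyMeasurable

lemma integrable_comp_eval_stdGaussian {n : ℕ} (i : Fin n) {f : ℝ → ℝ}
    (hf : Integrable f (gaussianReal 0 1)) :
    Integrable (fun x : Fin n → ℝ => f (x i)) (_root_.stdGaussian n) :=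
  integrable_comp_eval (μ := fun _ : Fin n => gaussianReal 0 1) hf

lemma integral_id_stdGaussian_fin (n : ℕ) : ∫ x, id x ∂(_root_.stdGaussian n) = 0 := by
  have := isGaussian_stdGaussian_fin n
  have hint : Integrable (fun x : Fin n → ℝ => x) (_root_.stdGaussian n) :=
    IsGaussian.integrable_id
  ext i
  have h := (ContinuousLinearMap.proj (R := ℝ) (φ := fun _ : Fin n => ℝ) i).integral_comp_comm hint
  have h2 := integral_comp_eval_stdGaussian i measurable_id
  simp only [ContinuousLinearMap.proj_apply, id_eq, integral_id_gaussianReal] at h h2 ⊢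
  rw [← h, h2, Pi.zero_apply]

lemma integral_exp_linear_stdGaussian {n : ℕ} (c : ℝ) (v : Fin n → ℝ) :
    ∫ x, Real.exp (c * ∑ i, v i * x i) ∂(_root_.stdGaussian n) =
      Real.exp (c ^ 2 * (∑ i, v i ^ 2) / 2) := by
  have h1 : ∀ x : Fin n → ℝ, Real.exp (c * ∑ i, v i * x i) = ∏ i, Real.exp (c * v i * x i) := by
    intro x
    rw [← Real.exp_sum, Finset.mul_sum]
    simp only [mul_assoc]
  simp_rw [h1]
  rw [_root_.stdGaussian, integral_fintype_prod_eq_prod (fun i y => Real.exp (c * v i * y))]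
  have h2 : ∀ i, ∫ y, Real.exp (c * v i * y) ∂(gaussianReal 0 1) =
      Real.exp ((c * v i) ^ 2 / 2) := by
    intro i
    have := congrFun (mgf_id_gaussianReal (μ := 0) (v := 1)) (c * v i)
    simpa [mgf] using this
  simp_rw [h2]
  rw [← Real.exp_sum, Finset.mul_sum, Finset.sum_div]
  simp only [mul_pow]

lemma integrable_exp_sum_abs_stdGaussian {n : ℕ} (c : ℝ) :
    Integrable (fun x : Fin n → ℝ => Real.exp (c * ∑ i, |x i|)) (_root_.stdGaussian n) := by
  have h1 : ∀ x : Fin n → ℝ, Real.exp (c * ∑ i, |x i|) = ∏ i, Real.exp (c * |x i|) := by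
    intro x
    rw [← Real.exp_sum, Finset.mul_sum]
  simp_rw [h1]
  refine Integrable.fintype_prod (f := fun _ y => Real.exp (c * |y|)) fun i => ?_
  exact integrable_exp_mul_abs (integrable_exp_mul_gaussianReal c)
    (integrable_exp_mul_gaussianReal (-c))

/-- Gaussian measure on a product is invariant under the rotation by `π / 4`. -/
lemma integral_rotation_stdGaussian {n : ℕ} {h : (Fin n → ℝ) × (Fin n → ℝ) → ℝ}
    (hh : Measurable h) :
    ∫ z, h ((√2)⁻¹ • (z.1 + z.2), (√2)⁻¹ • (z.2 - z.1))
        ∂(_root_.stdGaussian n).prod (_root_.stdGaussian n) =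
      ∫ z, h z ∂(_root_.stdGaussian n).prod (_root_.stdGaussian n) := by
  have := isGaussian_stdGaussian_fin n
  have hrot := IsGaussian.map_rotation_eq_self (integral_id_stdGaussian_fin n) (Real.pi / 4)
  conv_rhs => rw [← hrot]
  rw [integral_map (by fun_prop) hh.aestronglyMeasurable]
  congr 1
  ext z
  have hs : √2 / 2 = (√2)⁻¹ := by
    field_simp
    exact Real.sq_sqrt (by norm_num)
  rw [ContinuousLinearMap.rotation_apply, Real.cos_pi_div_four, Real.sin_pi_div_four, hs]
  congr 2
  · rw [smul_add]
  · rw [smul_sub, neg_smul]; abel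

variable {n : ℕ} {f : (Fin n → ℝ) → ℝ} {S : ℝ}

lemma integrable_exp_mul_of_subgradient (hf : Measurable f)
    (hv : ∀ x, ∃ v : Fin n → ℝ, ∑ i, v i ^ 2 ≤ S ∧ f x = ∑ i, v i * x i ∧
      ∀ y, ∑ i, v i * y i ≤ f y) (c : ℝ) :
    Integrable (fun x => Real.exp (c * f x)) (_root_.stdGaussian n) := by
  refine (integrable_exp_sum_abs_stdGaussian (|c| * √S)).mono'
    (by fun_prop) (Filter.Eventually.of_forall fun x => ?_)
  rw [Real.norm_eq_abs, Real.abs_exp, Real.exp_le_exp]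
  obtain ⟨v, hvS, hfx, -⟩ := hv x
  have hvi : ∀ i, |v i| ≤ √S := fun i =>
    Real.abs_le_sqrt ((Finset.single_le_sum (f := fun i => v i ^ 2)
      (fun j _ => sq_nonneg _) (Finset.mem_univ i)).trans hvS)
  have h1 : |f x| ≤ √S * ∑ i, |x i| := by
    rw [hfx, Finset.mul_sum]
    refine (Finset.abs_sum_le_sum_abs _ _).trans (Finset.sum_le_sum fun i _ => ?_)
    rw [abs_mul]
    exact mul_le_mul_of_nonneg_right (hvi i) (abs_nonneg _)
  calc c * f x ≤ |c * f x| := le_abs_self _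
    _ = |c| * |f x| := abs_mul _ _
    _ ≤ |c| * (√S * ∑ i, |x i|) := mul_le_mul_of_nonneg_left h1 (abs_nonneg _)
    _ = _ := by ring

/-- One step of the interpolation between two independent copies. -/
lemma integral_exp_sub_rotation_le (hf : Measurable f) (hf0 : ∀ x, 0 ≤ f x)
    (hv : ∀ x, ∃ v : Fin n → ℝ, ∑ i, v i ^ 2 ≤ S ∧ f x = ∑ i, v i * x i ∧
      ∀ y, ∑ i, v i * y i ≤ f y) {c : ℝ} (hc : 0 ≤ c) :
    Integrable (fun z : (Fin n → ℝ) × (Fin n → ℝ) =>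
        Real.exp (2 * c * (f z.1 - f ((√2)⁻¹ • (z.1 + z.2)))))
        ((_root_.stdGaussian n).prod (_root_.stdGaussian n)) ∧
    ∫ z, Real.exp (2 * c * (f z.1 - f ((√2)⁻¹ • (z.1 + z.2))))
        ∂(_root_.stdGaussian n).prod (_root_.stdGaussian n) ≤
      (∫ x, Real.exp (3 / 5 * c * f x) ∂(_root_.stdGaussian n)) * Real.exp (c ^ 2 * S) := by
  have hInt : Integrable (fun z : (Fin n → ℝ) × (Fin n → ℝ) =>
        Real.exp (2 * c * (f z.1 - f ((√2)⁻¹ • (z.1 + z.2)))))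
        ((_root_.stdGaussian n).prod (_root_.stdGaussian n)) := by
    refine ((integrable_exp_mul_of_subgradient hf hv (2 * c)).comp_fst
      (_root_.stdGaussian n)).mono' (by fun_prop) (Filter.Eventually.of_forall fun z => ?_)
    rw [Real.norm_eq_abs, Real.abs_exp, Real.exp_le_exp]
    have := hf0 ((√2)⁻¹ • (z.1 + z.2))
    gcongr
    linarith
  refine ⟨hInt, ?_⟩
  rw [integral_prod _ hInt, ← integral_mul_const]
  have hs : (√2)⁻¹ ^ 2 = 1 / 2 := by
    rw [inv_pow, Real.sq_sqrt (by norm_num)]; norm_num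
  have hs0 : (0 : ℝ) < (√2)⁻¹ := by positivity
  refine integral_mono_of_nonneg (Filter.Eventually.of_forall fun x =>
    integral_nonneg fun y => (Real.exp_pos _).le)
    ((integrable_exp_mul_of_subgradient hf hv _).mul_const _)
    (Filter.Eventually.of_forall fun x => ?_)
  obtain ⟨v, hvS, hfx, hvy⟩ := hv x
  set s := (√2)⁻¹ with hsdef
  have hsge : (7 : ℝ) / 10 ≤ s := by nlinarith
  have hpt : ∀ y, Real.exp (2 * c * (f x - f (s • (x + y)))) ≤
      Real.exp (3 / 5 * c * f x) * Real.exp (-(2 * c * s) * ∑ i, v i * y i) := by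
    intro y
    rw [← Real.exp_add, Real.exp_le_exp]
    have h1 := hvy (s • (x + y))
    have h2 : ∑ i, v i * (s • (x + y)) i = s * (f x + ∑ i, v i * y i) := by
      rw [hfx, ← Finset.sum_add_distrib, Finset.mul_sum]
      refine Finset.sum_congr rfl fun i _ => ?_
      simp only [Pi.smul_apply, Pi.add_apply, smul_eq_mul]; ring
    rw [h2] at h1
    have h3 : c * (s * (f x + ∑ i, v i * y i)) ≤ c * f (s • (x + y)) :=
      mul_le_mul_of_nonneg_left h1 hc
    have h4 : 0 ≤ c * f x * (s - 7 / 10) :=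
      mul_nonneg (mul_nonneg hc (hf0 x)) (by linarith)
    nlinarith
  calc ∫ y, Real.exp (2 * c * (f x - f (s • (x + y)))) ∂(_root_.stdGaussian n)
      ≤ ∫ y, Real.exp (3 / 5 * c * f x) * Real.exp (-(2 * c * s) * ∑ i, v i * y i)
          ∂(_root_.stdGaussian n) := by
        refine integral_mono_of_nonneg (Filter.Eventually.of_forall fun y => (Real.exp_pos _).le)
          (Integrable.const_mul ?_ _) (Filter.Eventually.of_forall hpt)
        by_contra hni
        have := integral_exp_linear_stdGaussian (-(2 * c * s)) v
        rw [integral_undef hni] at this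
        exact (Real.exp_pos _).ne this
    _ = Real.exp (3 / 5 * c * f x) * Real.exp (c ^ 2 * ∑ i, v i ^ 2) := by
        rw [integral_const_mul, integral_exp_linear_stdGaussian]
        congr 2
        have : (-(2 * c * s)) ^ 2 = 4 * c ^ 2 * s ^ 2 := by ring
        rw [this, hs]; ring
    _ ≤ Real.exp (3 / 5 * c * f x) * Real.exp (c ^ 2 * S) := by gcongr

/-- Sub-Gaussian moment generating function for a maximum of linear functionals. -/
lemma integral_exp_mul_le_of_subgradient (hf : Measurable f) (hf0 : ∀ x, 0 ≤ f x)
    (hv : ∀ x, ∃ v : Fin n → ℝ, ∑ i, v i ^ 2 ≤ S ∧ f x = ∑ i, v i * x i ∧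
      ∀ y, ∑ i, v i * y i ≤ f y) {c : ℝ} (hc : 0 ≤ c) (hfi : Integrable f (_root_.stdGaussian n)) :
    ∫ x, Real.exp (c * f x) ∂(_root_.stdGaussian n) ≤
      Real.exp (5 / 2 * (c * (∫ x, f x ∂(_root_.stdGaussian n)) + c ^ 2 * S)) := by
  set μ := _root_.stdGaussian n with hμ
  have hexp := integrable_exp_mul_of_subgradient hf hv
  obtain ⟨hI1, hb1⟩ := integral_exp_sub_rotation_le hf hf0 hv hc
  set h : (Fin n → ℝ) × (Fin n → ℝ) → ℝ := fun z =>
    Real.exp (2 * c * (f z.1 - f ((√2)⁻¹ • (z.1 + z.2)))) with hdef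
  have hhm : Measurable h := by fun_prop
  have hs : (√2)⁻¹ * (√2)⁻¹ = 1 / 2 := by
    rw [← sq, inv_pow, Real.sq_sqrt (by norm_num)]; norm_num
  have hrot : ∀ z : (Fin n → ℝ) × (Fin n → ℝ),
      h ((√2)⁻¹ • (z.1 + z.2), (√2)⁻¹ • (z.2 - z.1)) =
        Real.exp (2 * c * (f ((√2)⁻¹ • (z.1 + z.2)) - f z.2)) := by
    intro z
    have : (√2)⁻¹ • ((√2)⁻¹ • (z.1 + z.2) + (√2)⁻¹ • (z.2 - z.1)) = z.2 := by
      rw [← smul_add, smul_smul, hs]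
      ext i
      simp only [Pi.smul_apply, Pi.add_apply, Pi.sub_apply, smul_eq_mul]; ring
    simp only [hdef, this]
  have hb2 := integral_rotation_stdGaussian hhm
  simp_rw [hrot] at hb2
  have hI2 : Integrable (fun z : (Fin n → ℝ) × (Fin n → ℝ) =>
      Real.exp (2 * c * (f ((√2)⁻¹ • (z.1 + z.2)) - f z.2))) (μ.prod μ) := by
    by_contra hni
    rw [integral_undef hni] at hb2
    have : 0 < ∫ z, h z ∂(μ.prod μ) := integral_exp_pos hI1
    exact this.ne hb2
  set M : ℝ := ∫ x, Real.exp (c * f x) ∂μ with hM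
  set N : ℝ := ∫ x, Real.exp (3 / 5 * c * f x) ∂μ with hN
  have hM0 : 0 < M := integral_exp_pos (hexp c)
  have hN0 : 0 < N := integral_exp_pos (hexp (3 / 5 * c))
  have hprod : M * ∫ x, Real.exp (-c * f x) ∂μ ≤ N * Real.exp (c ^ 2 * S) := by
    rw [hM, ← integral_prod_mul]
    calc ∫ z, Real.exp (c * f z.1) * Real.exp (-c * f z.2) ∂(μ.prod μ)
        ≤ ∫ z, (h z + Real.exp (2 * c * (f ((√2)⁻¹ • (z.1 + z.2)) - f z.2))) / 2
            ∂(μ.prod μ) := by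
          refine integral_mono ((hexp c).mul_prod (hexp (-c))) ((hI1.add hI2).div_const 2) ?_
          intro z
          set a := c * (f z.1 - f ((√2)⁻¹ • (z.1 + z.2))) with ha
          set b := c * (f ((√2)⁻¹ • (z.1 + z.2)) - f z.2) with hb
          have e1 : Real.exp (c * f z.1) * Real.exp (-c * f z.2) = Real.exp a * Real.exp b := by
            rw [← Real.exp_add, ← Real.exp_add]; congr 1; rw [ha, hb]; ring
          have e2 : h z = Real.exp a ^ 2 := by
            rw [← Real.exp_nat_mul, ha]; simp only [hdef]; congr 1; push_cast; ring
          have e3 : Real.exp (2 * c * (f ((√2)⁻¹ • (z.1 + z.2)) - f z.2)) = Real.exp b ^ 2 := by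
            rw [← Real.exp_nat_mul]; congr 1; rw [hb]; push_cast; ring
          show Real.exp (c * f z.1) * Real.exp (-c * f z.2) ≤
            (h z + Real.exp (2 * c * (f ((√2)⁻¹ • (z.1 + z.2)) - f z.2))) / 2
          rw [e1, e2, e3]
          nlinarith [sq_nonneg (Real.exp a - Real.exp b)]
      _ ≤ N * Real.exp (c ^ 2 * S) := by
          rw [integral_div, integral_add hI1 hI2, hb2]
          linarith
  have hj1 : Real.exp (-c * ∫ x, f x ∂μ) ≤ ∫ x, Real.exp (-c * f x) ∂μ := by
    have := convexOn_exp.map_integral_le Real.continuous_exp.continuousOn isClosed_univ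
      (Filter.Eventually.of_forall fun _ => Set.mem_univ _) (hfi.const_mul (-c)) (hexp (-c))
    rwa [integral_const_mul] at this
  have hj2 : N ^ ((5 : ℝ) / 3) ≤ M := by
    have hpow : ∀ x, Real.exp (3 / 5 * c * f x) ^ ((5 : ℝ) / 3) = Real.exp (c * f x) := by
      intro x
      rw [← Real.exp_mul]; congr 1; ring
    have := (convexOn_rpow (p := 5 / 3) (by norm_num)).map_integral_le
      (Real.continuous_rpow_const (by norm_num)).continuousOn isClosed_Ici
      (Filter.Eventually.of_forall fun x => (Real.exp_pos (3 / 5 * c * f x)).le)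
      (hexp (3 / 5 * c)) (by
        refine (hexp c).congr (Filter.Eventually.of_forall fun x => (hpow x).symm))
    simpa only [hpow] using this
  have hl2 : 5 / 3 * Real.log N ≤ Real.log M := by
    rw [← Real.log_rpow hN0]
    exact Real.log_le_log (by positivity) hj2
  have hl1 : Real.log M - c * ∫ x, f x ∂μ ≤ Real.log N + c ^ 2 * S := by
    have h1 : M * Real.exp (-c * ∫ x, f x ∂μ) ≤ N * Real.exp (c ^ 2 * S) :=
      (mul_le_mul_of_nonneg_left hj1 hM0.le).trans hprod
    have h2 := Real.log_le_log (by positivity) h1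
    rw [Real.log_mul hM0.ne' (Real.exp_ne_zero _), Real.log_mul hN0.ne' (Real.exp_ne_zero _),
      Real.log_exp, Real.log_exp] at h2
    linarith
  rw [← Real.log_le_iff_le_exp hM0]
  linarith

/-- Concentration above a multiple of the mean for a maximum of linear functionals. -/
lemma measureReal_ge_le_of_subgradient (hf : Measurable f) (hf0 : ∀ x, 0 ≤ f x) {τ t : ℝ}
    (hτ : 0 < τ) (ht : 0 ≤ t)
    (hv : ∀ x, ∃ v : Fin n → ℝ, ∑ i, v i ^ 2 ≤ 3 * τ ^ 2 ∧ f x = ∑ i, v i * x i ∧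
      ∀ y, ∑ i, v i * y i ≤ f y) (hfi : Integrable f (_root_.stdGaussian n)) :
    (_root_.stdGaussian n).real
        {x | 5 / 2 * (∫ x, f x ∂(_root_.stdGaussian n)) + 5 * τ * t ≤ f x} ≤
      Real.exp (-t ^ 2 / 2) := by
  have hc : 0 ≤ t / (2 * τ) := by positivity
  refine (measure_ge_le_exp_mul_mgf _ hc
    (integrable_exp_mul_of_subgradient hf hv _)).trans ?_
  refine (mul_le_mul_of_nonneg_left (integral_exp_mul_le_of_subgradient hf hf0 hv hc hfi) (Real.exp_pos _).le).trans ?_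
  rw [← Real.exp_add, Real.exp_le_exp]
  have h1 : (t / (2 * τ)) ^ 2 * (3 * τ ^ 2) = 3 / 4 * t ^ 2 := by field_simp; ring
  have h2 : t / (2 * τ) * (5 * τ * t) = 5 / 2 * t ^ 2 := by field_simp
  nlinarith [sq_nonneg t]

end GaussianConcentration

section OrderStatistics

variable {n : ℕ}

lemma decRe_nonneg (x : Fin n → ℝ) (i : Fin n) : 0 ≤ decRe x i := abs_nonneg _

lemma decRe_antitone (x : Fin n → ℝ) : Antitone (decRe x) := fun _ _ h =>
  Tuple.monotone_sort (fun j => |x j|) (Fin.rev_le_rev.2 h)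

/-- The permutation ordering the coordinates of `x` by non-increasing absolute value. -/
noncomputable def decPerm (x : Fin n → ℝ) : Equiv.Perm (Fin n) :=
  Fin.revPerm.trans (Tuple.sort fun j => |x j|)

lemma decRe_eq_abs_decPerm (x : Fin n → ℝ) (i : Fin n) : decRe x i = |x (decPerm x i)| := rfl

lemma sum_comp_decRe (g : ℝ → ℝ) (x : Fin n → ℝ) : ∑ i, g (decRe x i) = ∑ j, g |x j| :=
  Equiv.sum_comp (decPerm x) fun j => g |x j|

lemma sum_mul_abs_perm_le {w : Fin n → ℝ} (hw : Antitone w) (y : Fin n → ℝ)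
    (π : Equiv.Perm (Fin n)) : ∑ i, w i * |y (π i)| ≤ ∑ i, w i * decRe y i := by
  have h := ((decRe_antitone y).monovary hw).sum_comp_perm_mul_le_sum_mul
    (σ := π.trans (decPerm y).symm)
  simpa [decRe_eq_abs_decPerm, mul_comm] using h

lemma measurable_sum_mul_decRe {w : Fin n → ℝ} (hw : Antitone w) :
    Measurable fun x : Fin n → ℝ => ∑ i, w i * decRe x i := by
  have h : (fun x : Fin n → ℝ => ∑ i, w i * decRe x i) =
      (Finset.univ : Finset (Equiv.Perm (Fin n))).sup' Finset.univ_nonempty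
        fun π (x : Fin n → ℝ) => ∑ i, w i * |x (π i)| := by
    ext x
    rw [Finset.sup'_apply]
    refine le_antisymm ?_ (Finset.sup'_le _ _ fun π _ => sum_mul_abs_perm_le hw x π)
    exact Finset.le_sup' (fun π : Equiv.Perm (Fin n) => ∑ i, w i * |x (π i)|)
      (Finset.mem_univ (decPerm x))
  rw [h]
  refine Finset.measurable_sup' _ fun π _ => ?_
  fun_prop

lemma exists_subgradient_sum_mul_decRe {w : Fin n → ℝ} (hw : Antitone w) (hw0 : ∀ i, 0 ≤ w i)
    (x : Fin n → ℝ) : ∃ v : Fin n → ℝ, ∑ i, v i ^ 2 ≤ ∑ i, w i ^ 2 ∧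
      ∑ i, w i * decRe x i = ∑ i, v i * x i ∧ ∀ y, ∑ i, v i * y i ≤ ∑ i, w i * decRe y i := by
  set π := decPerm x with hπ
  let ε : ℝ → ℝ := fun a => if 0 ≤ a then 1 else -1
  have hε : ∀ a, ε a * a = |a| := by
    intro a
    by_cases h : 0 ≤ a
    · simp [ε, h, abs_of_nonneg]
    · simp [ε, h, abs_of_neg (not_le.1 h)]
  have hε2 : ∀ a, ε a ^ 2 = 1 := by
    intro a
    by_cases h : 0 ≤ a <;> simp [ε, h]
  have hεle : ∀ a b, ε a * b ≤ |b| := by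
    intro a b
    by_cases h : 0 ≤ a
    · simp [ε, h, le_abs_self]
    · simp [ε, h, neg_le_abs]
  refine ⟨fun j => w (π.symm j) * ε (x j), ?_, ?_, fun y => ?_⟩
  · rw [← Equiv.sum_comp π]
    simp [mul_pow, hε2]
  · rw [← Equiv.sum_comp π fun j => w (π.symm j) * ε (x j) * x j]
    simp [mul_assoc, hε, decRe_eq_abs_decPerm, hπ]
  · rw [← Equiv.sum_comp π]
    refine le_trans (Finset.sum_le_sum fun i _ => ?_) (sum_mul_abs_perm_le hw y π)
    simp only [Equiv.symm_apply_apply, mul_assoc]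
    exact mul_le_mul_of_nonneg_left (hεle _ _) (hw0 i)

end OrderStatistics

section PowerSums

lemma sum_rpow_neg_le {a : ℝ} (ha0 : 0 ≤ a) (ha1 : a < 1) (m : ℕ) :
    ∑ i ∈ Finset.range (m + 1), ((i : ℝ) + 1) ^ (-a) ≤
      1 + (((m : ℝ) + 1) ^ (1 - a) - 1) / (1 - a) := by
  have hb : 0 < 1 - a := by linarith
  induction m with
  | zero => simp
  | succ m ih =>
    rw [Finset.sum_range_succ]
    push_cast
    set k : ℝ := (m : ℝ) + 1 + 1 with hk
    have hk1 : (1 : ℝ) < k := by have : (0 : ℝ) ≤ m := Nat.cast_nonneg m; linarith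
    have hk0 : 0 < k := by linarith
    have hm : (m : ℝ) + 1 = k * (1 + -(1 / k)) := by field_simp; linarith
    have h1 : (1 + -(1 / k)) ^ (1 - a) ≤ 1 + (1 - a) * (-(1 / k)) :=
      rpow_one_add_le_one_add_mul_self
        (by rw [neg_le_neg_iff]; exact (div_le_one hk0).2 hk1.le) hb.le (by linarith)
    have h0 : 0 ≤ 1 + -(1 / k) := by
      have : 1 / k ≤ 1 := (div_le_one hk0).2 hk1.le
      linarith
    have h2 : ((m : ℝ) + 1) ^ (1 - a) ≤ k ^ (1 - a) - (1 - a) * k ^ (-a) := by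
      rw [hm, Real.mul_rpow hk0.le h0]
      calc k ^ (1 - a) * (1 + -(1 / k)) ^ (1 - a)
          ≤ k ^ (1 - a) * (1 + (1 - a) * (-(1 / k))) := by gcongr
        _ = _ := by
          have : k ^ (1 - a) = k * k ^ (-a) := by
            rw [sub_eq_add_neg, Real.rpow_add hk0, Real.rpow_one]
          rw [this]; field_simp; ring
    have h3 : (((m : ℝ) + 1) ^ (1 - a) - 1) / (1 - a) + k ^ (-a) ≤
        (k ^ (1 - a) - 1) / (1 - a) := by
      rw [div_add' _ _ _ hb.ne', div_le_div_iff_of_pos_right hb]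
      linarith
    linarith

lemma sum_fin_rpow_neg_le {a : ℝ} (ha0 : 0 ≤ a) (ha1 : a < 1) {n : ℕ} (hn : 1 ≤ n) :
    ∑ i : Fin n, ((i : ℝ) + 1) ^ (-a) ≤ 1 + ((n : ℝ) ^ (1 - a) - 1) / (1 - a) := by
  obtain ⟨m, rfl⟩ := Nat.exists_eq_add_of_le' hn
  rw [Fin.sum_univ_eq_sum_range (fun i => ((i : ℝ) + 1) ^ (-a))]
  push_cast
  exact sum_rpow_neg_le ha0 ha1 m

lemma sum_fin_rpow_neg_le_div {a : ℝ} (ha0 : 0 ≤ a) (ha1 : a < 1) {n : ℕ} (hn : 1 ≤ n) :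
    ∑ i : Fin n, ((i : ℝ) + 1) ^ (-a) ≤ (n : ℝ) ^ (1 - a) / (1 - a) := by
  refine (sum_fin_rpow_neg_le ha0 ha1 hn).trans ?_
  have hb : 0 < 1 - a := by linarith
  rw [← sub_nonneg]
  have : (n : ℝ) ^ (1 - a) / (1 - a) - (1 + ((n : ℝ) ^ (1 - a) - 1) / (1 - a)) =
      a / (1 - a) := by field_simp; ring
  rw [this]; positivity

/-- The bound that stays sharp, including the logarithm, as `a → 1`. -/
lemma sum_fin_rpow_neg_le_log {a : ℝ} (ha0 : 0 ≤ a) (ha1 : a < 1) {n : ℕ} (hn : 3 ≤ n) :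
    ∑ i : Fin n, ((i : ℝ) + 1) ^ (-a) ≤
      3 * ((n : ℝ) ^ (1 - a) * (Real.log n / (1 + (1 - a) * Real.log n))) := by
  refine (sum_fin_rpow_neg_le ha0 ha1 (by omega)).trans ?_
  have hb : 0 < 1 - a := by linarith
  have hn0 : (0 : ℝ) < n := by positivity
  have hlog : 1 ≤ Real.log n := by
    rw [Real.le_log_iff_exp_le hn0]
    have : (3 : ℝ) ≤ n := by exact_mod_cast hn
    exact Real.exp_one_lt_d9.le.trans (by linarith)
  set L := Real.log n with hL
  set u := (1 - a) * L with hu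
  have hu0 : 0 < u := by positivity
  have hpow : (n : ℝ) ^ (1 - a) = Real.exp u := by
    rw [Real.rpow_def_of_pos hn0, hu, mul_comm]
  have hba : 1 - a = u / L := by rw [hu]; field_simp
  have h1 : 1 + u ≤ Real.exp u := by linarith [Real.add_one_le_exp u]
  have h2 : Real.exp u * (1 - u) ≤ 1 := by
    calc Real.exp u * (1 - u) ≤ Real.exp u * Real.exp (-u) := by
          gcongr; linarith [Real.add_one_le_exp (-u)]
      _ = 1 := by rw [← Real.exp_add]; simp
  rw [hpow]
  have h3 : 1 ≤ Real.exp u * (L / (1 + u)) := by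
    rw [← mul_div_assoc, le_div_iff₀ (by linarith)]
    nlinarith
  have h4 : (Real.exp u - 1) / (1 - a) ≤ 2 * (Real.exp u * (L / (1 + u))) := by
    rw [hba, div_div_eq_mul_div, ← mul_div_assoc, ← mul_div_assoc,
      div_le_div_iff₀ hu0 (by linarith)]
    have : (Real.exp u - 1) * (1 + u) ≤ 2 * Real.exp u * u := by nlinarith
    nlinarith
  linarith

end PowerSums

section WeightedSums

lemma sum_mul_rpow_le {ι : Type*} {s : Finset ι} {w a : ι → ℝ} (hw : ∀ i ∈ s, 0 ≤ w i)
    (ha : ∀ i ∈ s, 0 ≤ a i) (hW : 0 < ∑ i ∈ s, w i) {q : ℝ} (hq0 : 0 ≤ q) (hq1 : q ≤ 1) :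
    ∑ i ∈ s, w i * a i ^ q ≤ (∑ i ∈ s, w i) ^ (1 - q) * (∑ i ∈ s, w i * a i) ^ q := by
  set W := ∑ i ∈ s, w i with hWdef
  have h := (Real.concaveOn_rpow hq0 hq1).le_map_sum (t := s) (w := fun i => w i / W) (p := a)
    (fun i hi => div_nonneg (hw i hi) hW.le)
    (by rw [← Finset.sum_div, ← hWdef, div_self hW.ne']) ha
  simp only [smul_eq_mul, div_mul_eq_mul_div] at h
  rw [← Finset.sum_div, ← Finset.sum_div, Real.div_rpow
    (Finset.sum_nonneg fun i hi => mul_nonneg (hw i hi) (ha i hi)) hW.le,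
    div_le_iff₀ hW] at h
  refine h.trans (le_of_eq ?_)
  rw [Real.rpow_sub hW, Real.rpow_one]
  ring

variable {n : ℕ} {r : ℝ}

lemma antitone_rpow_neg_fin (hr : 0 ≤ r) :
    Antitone fun i : Fin n => ((i : ℝ) + 1) ^ (-(2 * r)) := by
  intro i j hij
  have : (i : ℝ) ≤ j := by exact_mod_cast hij
  exact Real.rpow_le_rpow_of_nonpos (by positivity) (by linarith) (by linarith)

lemma sum_rpow_mul_decRe_le (hr : 0 ≤ r) (hr4 : r < 1 / 4) (hn : 1 ≤ n) (x : Fin n → ℝ) :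
    ∑ i : Fin n, ((i : ℝ) + 1) ^ (-(2 * r)) * decRe x i ≤
      4 * (n : ℝ) ^ (1 - 2 * r) + (n : ℝ) ^ (-(2 * r)) * ∑ j, x j ^ 4 := by
  have hn0 : (0 : ℝ) < n := by positivity
  have hterm : ∀ i : Fin n, ((i : ℝ) + 1) ^ (-(2 * r)) * decRe x i ≤
      (n : ℝ) ^ ((1 : ℝ) / 4) * ((i : ℝ) + 1) ^ (-(2 * r + 1 / 4)) +
        (n : ℝ) ^ (-(2 * r)) * decRe x i ^ 4 := by
    intro i
    set k : ℝ := (i : ℝ) + 1 with hk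
    have hk0 : 0 < k := by positivity
    have hkn : k ≤ n := by rw [hk]; exact_mod_cast i.2
    set a := decRe x i
    have ha : 0 ≤ a := decRe_nonneg x i
    set u : ℝ := (n : ℝ) ^ ((1 : ℝ) / 4) * k ^ (-(1 / 4 : ℝ)) with hu
    have hu0 : 0 < u := by positivity
    have hau : a ≤ u + a ^ 4 / u ^ 3 := by
      rcases le_or_gt a u with h | h
      · have : 0 ≤ a ^ 4 / u ^ 3 := by positivity
        linarith
      · have : a ≤ a ^ 4 / u ^ 3 := by
          rw [le_div_iff₀ (by positivity), pow_succ a 3, mul_comm]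
          gcongr
        linarith
    have hu3 : k ^ (-(2 * r)) / u ^ 3 ≤ (n : ℝ) ^ (-(2 * r)) := by
      have e1 : u ^ 3 = (n : ℝ) ^ ((3 : ℝ) / 4) * k ^ (-(3 / 4 : ℝ)) := by
        rw [hu, mul_pow, ← Real.rpow_natCast, ← Real.rpow_natCast, ← Real.rpow_mul hn0.le,
          ← Real.rpow_mul hk0.le]
        norm_num
      rw [e1, div_le_iff₀ (by positivity)]
      have e2 : (n : ℝ) ^ (-(2 * r)) * ((n : ℝ) ^ ((3 : ℝ) / 4) * k ^ (-(3 / 4 : ℝ))) =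
          (n : ℝ) ^ (3 / 4 - 2 * r) * k ^ (-(3 / 4 : ℝ)) := by
        rw [← mul_assoc, ← Real.rpow_add hn0]; ring_nf
      have e3 : k ^ (-(2 * r)) = k ^ (3 / 4 - 2 * r) * k ^ (-(3 / 4 : ℝ)) := by
        rw [← Real.rpow_add hk0]; ring_nf
      rw [e2, e3]
      gcongr
      linarith
    calc k ^ (-(2 * r)) * a ≤ k ^ (-(2 * r)) * (u + a ^ 4 / u ^ 3) := by gcongr
      _ = k ^ (-(2 * r)) * u + k ^ (-(2 * r)) / u ^ 3 * a ^ 4 := by ring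
      _ ≤ k ^ (-(2 * r)) * u + (n : ℝ) ^ (-(2 * r)) * a ^ 4 := by gcongr
      _ = _ := by
        congr 1
        rw [hu, mul_left_comm, ← Real.rpow_add hk0]
        ring_nf
  refine (Finset.sum_le_sum fun i _ => hterm i).trans ?_
  rw [Finset.sum_add_distrib, ← Finset.mul_sum, ← Finset.mul_sum,
    sum_comp_decRe (fun y => y ^ 4)]
  simp only [Even.pow_abs (by decide : Even 4)]
  refine add_le_add_left ?_ _
  have h1 := sum_fin_rpow_neg_le_div (a := 2 * r + 1 / 4) (by linarith) (by linarith) hn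
  calc (n : ℝ) ^ ((1 : ℝ) / 4) * ∑ i : Fin n, ((i : ℝ) + 1) ^ (-(2 * r + 1 / 4))
      ≤ (n : ℝ) ^ ((1 : ℝ) / 4) *
        ((n : ℝ) ^ (1 - (2 * r + 1 / 4)) / (1 - (2 * r + 1 / 4))) := by gcongr
    _ = (n : ℝ) ^ (1 - 2 * r) / (1 - (2 * r + 1 / 4)) := by
        rw [← mul_div_assoc, ← Real.rpow_add hn0]; ring_nf
    _ ≤ 4 * (n : ℝ) ^ (1 - 2 * r) := by
        have : 0 ≤ (n : ℝ) ^ (1 - 2 * r) := by positivity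
        rw [div_le_iff₀ (by linarith)]
        nlinarith

lemma integrable_pow_four_gaussianReal : Integrable (fun y : ℝ => y ^ 4) (gaussianReal 0 1) := by
  have h := (memLp_id_gaussianReal (μ := 0) (v := 1) 4).integrable_norm_pow (p := 4) (by norm_num)
  simpa [Even.pow_abs (by decide : Even 4)] using h

lemma integrable_sum_rpow_mul_decRe (hr : 0 ≤ r) (hr4 : r < 1 / 4) (hn : 1 ≤ n) :
    Integrable (fun x : Fin n → ℝ => ∑ i : Fin n, ((i : ℝ) + 1) ^ (-(2 * r)) * decRe x i)
        (_root_.stdGaussian n) ∧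
      ∫ x, ∑ i : Fin n, ((i : ℝ) + 1) ^ (-(2 * r)) * decRe x i ∂(_root_.stdGaussian n) ≤
        (4 + ∫ y, y ^ 4 ∂(gaussianReal 0 1)) * (n : ℝ) ^ (1 - 2 * r) := by
  have hn0 : (0 : ℝ) < n := by positivity
  have hnonneg : ∀ x : Fin n → ℝ, 0 ≤ ∑ i : Fin n, ((i : ℝ) + 1) ^ (-(2 * r)) * decRe x i :=
    fun x => Finset.sum_nonneg fun i _ => mul_nonneg (by positivity) (decRe_nonneg x i)
  have hI4 : ∀ j : Fin n, Integrable (fun x : Fin n → ℝ => x j ^ 4) (_root_.stdGaussian n) :=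
    fun j => integrable_comp_eval_stdGaussian j integrable_pow_four_gaussianReal
  have hI : Integrable (fun x : Fin n → ℝ => 4 * (n : ℝ) ^ (1 - 2 * r) +
      (n : ℝ) ^ (-(2 * r)) * ∑ j, x j ^ 4) (_root_.stdGaussian n) :=
    (integrable_const _).add ((integrable_finsetSum _ fun j _ => hI4 j).const_mul _)
  have hF : Integrable (fun x : Fin n → ℝ =>
      ∑ i : Fin n, ((i : ℝ) + 1) ^ (-(2 * r)) * decRe x i) (_root_.stdGaussian n) := by
    refine hI.mono' (measurable_sum_mul_decRe (antitone_rpow_neg_fin hr)).aestronglyMeasurable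
      (Filter.Eventually.of_forall fun x => ?_)
    rw [Real.norm_eq_abs, abs_of_nonneg (hnonneg x)]
    exact sum_rpow_mul_decRe_le hr hr4 hn x
  refine ⟨hF, (integral_mono hF hI fun x => sum_rpow_mul_decRe_le hr hr4 hn x).trans
    (le_of_eq ?_)⟩
  rw [integral_add (integrable_const _) ((integrable_finsetSum _ fun j _ => hI4 j).const_mul _),
    integral_const_mul ((n : ℝ) ^ (-(2 * r))), integral_finsetSum _ fun j _ => hI4 j]
  simp_rw [fun j : Fin n => integral_comp_eval_stdGaussian j (f := fun y => y ^ 4) (by fun_prop)]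
  have : (n : ℝ) ^ (1 - 2 * r) = n * (n : ℝ) ^ (-(2 * r)) := by
    rw [sub_eq_add_neg, Real.rpow_add hn0, Real.rpow_one]
  simp only [integral_const, probReal_univ, Finset.sum_const, Finset.card_univ, Fintype.card_fin,
    nsmul_eq_mul, one_smul]
  rw [this]; ring

/-- Upper bound for the weighted sum of powers by the weighted sum, via concavity. -/
lemma sum_rpow_mul_decRe_rpow_le {p : ℝ} (hr : 0 ≤ r) (hr4 : r < 1 / 4) (hp1 : 1 ≤ p)
    (hp : p < 3 / 2) (hn : 1 ≤ n) (x : Fin n → ℝ) :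
    ∑ i : Fin n, ((i : ℝ) + 1) ^ (-(2 * r)) * decRe x i ^ (2 * (p - 1)) ≤
      2 * (n : ℝ) ^ ((1 - 2 * r) * (3 - 2 * p)) *
        (∑ i : Fin n, ((i : ℝ) + 1) ^ (-(2 * r)) * decRe x i) ^ (2 * (p - 1)) := by
  have hn0 : (0 : ℝ) < n := by positivity
  have hF : 0 ≤ ∑ i : Fin n, ((i : ℝ) + 1) ^ (-(2 * r)) * decRe x i :=
    Finset.sum_nonneg fun i _ => mul_nonneg (by positivity) (decRe_nonneg x i)
  have hW : 0 < ∑ i : Fin n, ((i : ℝ) + 1) ^ (-(2 * r)) :=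
    Finset.sum_pos (fun i _ => by positivity) ⟨⟨0, hn⟩, Finset.mem_univ _⟩
  have hWle : ∑ i : Fin n, ((i : ℝ) + 1) ^ (-(2 * r)) ≤ 2 * (n : ℝ) ^ (1 - 2 * r) := by
    refine (sum_fin_rpow_neg_le_div (by linarith) (by linarith) hn).trans ?_
    have : 0 ≤ (n : ℝ) ^ (1 - 2 * r) := by positivity
    rw [div_le_iff₀ (by linarith)]
    nlinarith
  refine (sum_mul_rpow_le (fun i _ => by positivity) (fun i _ => decRe_nonneg x i) hW
    (by linarith) (by linarith)).trans ?_
  refine mul_le_mul_of_nonneg_right ?_ (Real.rpow_nonneg hF _)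
  rw [show 1 - 2 * (p - 1) = 3 - 2 * p by ring]
  refine (Real.rpow_le_rpow hW.le hWle (by linarith)).trans ?_
  rw [Real.mul_rpow (by norm_num) (by positivity), ← Real.rpow_mul hn0.le]
  gcongr
  calc (2 : ℝ) ^ (3 - 2 * p) ≤ 2 ^ (1 : ℝ) :=
        Real.rpow_le_rpow_of_exponent_le (by norm_num) (by linarith)
    _ = 2 := Real.rpow_one 2

/-- Tail bound for the weighted sum of order statistics. -/
lemma measureReal_sum_rpow_mul_decRe_ge_le (hr : 0 ≤ r) (hr4 : r < 1 / 4) (hn : 3 ≤ n) {t : ℝ}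
    (ht : 0 ≤ t) :
    (_root_.stdGaussian n).real {x : Fin n → ℝ |
        5 / 2 * ((4 + ∫ y, y ^ 4 ∂(gaussianReal 0 1)) * (n : ℝ) ^ (1 - 2 * r)) +
          5 * ((n : ℝ) ^ ((1 - 4 * r) / 2) *
            (Real.log n / (1 + (1 - 4 * r) * Real.log n)) ^ ((1 : ℝ) / 2)) * t ≤
        ∑ i : Fin n, ((i : ℝ) + 1) ^ (-(2 * r)) * decRe x i} ≤ Real.exp (-t ^ 2 / 2) := by
  have hn0 : (0 : ℝ) < n := by positivity
  have hlog : 0 < Real.log n := Real.log_pos (by exact_mod_cast (by omega : 1 < n))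
  have hL : 0 < Real.log n / (1 + (1 - 4 * r) * Real.log n) := by
    have : 0 < (1 - 4 * r) * Real.log n := mul_pos (by linarith) hlog
    positivity
  set τ : ℝ := (n : ℝ) ^ ((1 - 4 * r) / 2) *
    (Real.log n / (1 + (1 - 4 * r) * Real.log n)) ^ ((1 : ℝ) / 2) with hτ
  have hτ0 : 0 < τ := by positivity
  have hanti := antitone_rpow_neg_fin (n := n) hr
  obtain ⟨hint, hmean⟩ := integrable_sum_rpow_mul_decRe hr hr4 (by omega : 1 ≤ n)
  have hsq : ∑ i : Fin n, (((i : ℝ) + 1) ^ (-(2 * r))) ^ 2 ≤ 3 * τ ^ 2 := by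
    have e1 : τ ^ 2 = (n : ℝ) ^ (1 - 4 * r) *
        (Real.log n / (1 + (1 - 4 * r) * Real.log n)) := by
      rw [hτ, mul_pow, ← Real.rpow_natCast, ← Real.rpow_natCast, ← Real.rpow_mul hn0.le,
        ← Real.rpow_mul hL.le]
      norm_num
    have e2 : ∀ i : Fin n, (((i : ℝ) + 1) ^ (-(2 * r))) ^ 2 = ((i : ℝ) + 1) ^ (-(4 * r)) := by
      intro i
      rw [← Real.rpow_natCast, ← Real.rpow_mul (by positivity)]
      congr 1; push_cast; ring
    simp_rw [e1, e2]
    exact sum_fin_rpow_neg_le_log (by linarith) (by linarith) hn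
  refine (measureReal_mono ?_).trans (measureReal_ge_le_of_subgradient
    (measurable_sum_mul_decRe hanti)
    (fun x => Finset.sum_nonneg fun i _ => mul_nonneg (by positivity) (decRe_nonneg x i)) hτ0 ht
    (fun x => ?_) hint)
  · intro x hx
    simp only [Set.mem_ofPred_eq] at hx ⊢
    linarith
  · obtain ⟨v, hv, h⟩ := exists_subgradient_sum_mul_decRe hanti (fun i => by positivity) x
    exact ⟨v, hv.trans hsq, h⟩

end WeightedSums

/-- Case III: there is a universal constant `C > 0` such that for `n ≥ 3`, `t > 0`, `r ≥ 0`,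
`p ∈ [1, 3/2)` with `p < 3/2 - 2r`, and `X` standard Gaussian in `ℝ^n`:
(i) `∑ i^{-2r} x_[i]^{2(p-1)} ≤ C n^{(1-2r)(3-2p)} (∑ i^{-2r} x_[i])^{2(p-1)}` for all `x`;
(ii) with probability at least `1 - C exp(-t²/2)`,
`∑ i^{-2r} X_[i] ≤ C n^{1-2r} + C n^{(1-4r)/2} (ln n / (1+(1-4r) ln n))^{1/2} t`, and
consequently
`∑ i^{-2r} X_[i]^{2(p-1)} ≤ C n^{1-2r} + C n^{2-2r-p} (ln n / (1+(1-4r) ln n))^{p-1} t^{2(p-1)}`. -/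
theorem gradient_bound_case_III :
    ∃ C : ℝ, 0 < C ∧
      ∀ (n : ℕ) (t r p : ℝ), 3 ≤ n → 0 < t → 0 ≤ r → 1 ≤ p → p < 3 / 2 →
        p < 3 / 2 - 2 * r →
        (∀ x : Fin n → ℝ,
          ∑ i : Fin n, ((i : ℝ) + 1) ^ (-(2 * r)) * decRe x i ^ (2 * (p - 1)) ≤
            C * (n : ℝ) ^ ((1 - 2 * r) * (3 - 2 * p)) *
              (∑ i : Fin n, ((i : ℝ) + 1) ^ (-(2 * r)) * decRe x i) ^ (2 * (p - 1))) ∧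
        (1 - C * Real.exp (-t ^ 2 / 2) ≤
          ((stdGaussian n) {x |
            (∑ i : Fin n, ((i : ℝ) + 1) ^ (-(2 * r)) * decRe x i) ≤
              C * (n : ℝ) ^ (1 - 2 * r) + C * (n : ℝ) ^ ((1 - 4 * r) / 2) *
                (Real.log n / (1 + (1 - 4 * r) * Real.log n)) ^ ((1 : ℝ) / 2) * t ∧
            (∑ i : Fin n, ((i : ℝ) + 1) ^ (-(2 * r)) * decRe x i ^ (2 * (p - 1))) ≤
              C * (n : ℝ) ^ (1 - 2 * r) + C * (n : ℝ) ^ (2 - 2 * r - p) *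
                (Real.log n / (1 + (1 - 4 * r) * Real.log n)) ^ (p - 1) *
                t ^ (2 * (p - 1))}).toReal) := by
  set G : ℝ := ∫ y, y ^ 4 ∂(gaussianReal 0 1) with hG
  have hG0 : 0 ≤ G := integral_nonneg fun y => by positivity
  set K : ℝ := 5 / 2 * (4 + G) with hK
  have hK1 : 10 ≤ K := by rw [hK]; linarith
  refine ⟨2 * K, by linarith, fun n t r p hn ht hr hp1 hp hpr => ?_⟩
  have hr4 : r < 1 / 4 := by linarith
  have hn0 : (0 : ℝ) < n := by positivity
  have hlog : 0 < Real.log n := Real.log_pos (by exact_mod_cast (by omega : 1 < n))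
  have hL : 0 < Real.log n / (1 + (1 - 4 * r) * Real.log n) := by
    have : 0 < (1 - 4 * r) * Real.log n := mul_pos (by linarith) hlog
    positivity
  have hF : ∀ x : Fin n → ℝ, 0 ≤ ∑ i : Fin n, ((i : ℝ) + 1) ^ (-(2 * r)) * decRe x i :=
    fun x => Finset.sum_nonneg fun i _ => mul_nonneg (by positivity) (decRe_nonneg x i)
  have hpow := sum_rpow_mul_decRe_rpow_le hr hr4 hp1 hp (by omega : 1 ≤ n)
  refine ⟨fun x => (hpow x).trans ?_, ?_⟩
  · refine mul_le_mul_of_nonneg_right ?_ (Real.rpow_nonneg (hF x) _)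
    gcongr
    linarith
  have htail := measureReal_sum_rpow_mul_decRe_ge_le hr hr4 hn ht.le
  set L := Real.log n / (1 + (1 - 4 * r) * Real.log n) with hLdef
  set B : Set (Fin n → ℝ) := {x | 5 / 2 * ((4 + G) * (n : ℝ) ^ (1 - 2 * r)) +
    5 * ((n : ℝ) ^ ((1 - 4 * r) / 2) * L ^ ((1 : ℝ) / 2)) * t ≤
      ∑ i : Fin n, ((i : ℝ) + 1) ^ (-(2 * r)) * decRe x i} with hB
  have hBm : MeasurableSet B :=
    measurableSet_le measurable_const (measurable_sum_mul_decRe (antitone_rpow_neg_fin hr))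
  have hcompl := probReal_compl_eq_one_sub (μ := _root_.stdGaussian n) hBm
  have hexp : Real.exp (-t ^ 2 / 2) ≤ 2 * K * Real.exp (-t ^ 2 / 2) :=
    le_mul_of_one_le_left (Real.exp_pos _).le (by linarith)
  refine le_trans (by rw [hcompl]; linarith) (measureReal_mono (s₁ := Bᶜ) fun x hx => ?_)
  have hx' : ∑ i : Fin n, ((i : ℝ) + 1) ^ (-(2 * r)) * decRe x i ≤
      K * ((n : ℝ) ^ (1 - 2 * r) + (n : ℝ) ^ ((1 - 4 * r) / 2) * L ^ ((1 : ℝ) / 2) * t) := by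
    simp only [hB, Set.mem_compl_iff, Set.mem_ofPred_eq, not_le] at hx
    have : 0 ≤ (n : ℝ) ^ ((1 - 4 * r) / 2) * L ^ ((1 : ℝ) / 2) * t := by positivity
    rw [← mul_assoc, ← hK] at hx
    nlinarith
  have hs0 : 0 ≤ 2 * (p - 1) := by linarith
  refine ⟨hx'.trans ?_, (hpow x).trans ?_⟩
  · have h1 : 0 ≤ (n : ℝ) ^ ((1 - 4 * r) / 2) * L ^ ((1 : ℝ) / 2) * t := by positivity
    have h2 : 0 ≤ (n : ℝ) ^ (1 - 2 * r) := by positivity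
    nlinarith
  · have h1 : (∑ i : Fin n, ((i : ℝ) + 1) ^ (-(2 * r)) * decRe x i) ^ (2 * (p - 1)) ≤
        K * (((n : ℝ) ^ (1 - 2 * r)) ^ (2 * (p - 1)) +
          ((n : ℝ) ^ ((1 - 4 * r) / 2) * L ^ ((1 : ℝ) / 2) * t) ^ (2 * (p - 1))) := by
      refine (Real.rpow_le_rpow (hF x) hx' hs0).trans ?_
      rw [Real.mul_rpow (by linarith) (by positivity)]
      refine mul_le_mul ?_ (Real.rpow_add_le_add_rpow (by positivity) (by positivity) hs0
        (by linarith)) (by positivity) (by linarith)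
      calc K ^ (2 * (p - 1)) ≤ K ^ (1 : ℝ) :=
            Real.rpow_le_rpow_of_exponent_le (by linarith) (by linarith)
        _ = K := Real.rpow_one K
    have e1 : (n : ℝ) ^ ((1 - 2 * r) * (3 - 2 * p)) *
        ((n : ℝ) ^ (1 - 2 * r)) ^ (2 * (p - 1)) = (n : ℝ) ^ (1 - 2 * r) := by
      rw [← Real.rpow_mul hn0.le, ← Real.rpow_add hn0]; ring_nf
    have e2 : (n : ℝ) ^ ((1 - 2 * r) * (3 - 2 * p)) *
        ((n : ℝ) ^ ((1 - 4 * r) / 2) * L ^ ((1 : ℝ) / 2) * t) ^ (2 * (p - 1)) =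
          (n : ℝ) ^ (2 - 2 * r - p) * L ^ (p - 1) * t ^ (2 * (p - 1)) := by
      rw [Real.mul_rpow (by positivity) ht.le, Real.mul_rpow (by positivity) (by positivity),
        ← Real.rpow_mul hn0.le, ← Real.rpow_mul hL.le, ← mul_assoc, ← mul_assoc,
        ← Real.rpow_add hn0]
      ring_nf
    calc _ ≤ 2 * (n : ℝ) ^ ((1 - 2 * r) * (3 - 2 * p)) *
          (K * (((n : ℝ) ^ (1 - 2 * r)) ^ (2 * (p - 1)) +
          ((n : ℝ) ^ ((1 - 4 * r) / 2) * L ^ ((1 : ℝ) / 2) * t) ^ (2 * (p - 1)))) := by gcongr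
      _ = 2 * K * ((n : ℝ) ^ ((1 - 2 * r) * (3 - 2 * p)) *
            ((n : ℝ) ^ (1 - 2 * r)) ^ (2 * (p - 1))) +
          2 * K * ((n : ℝ) ^ ((1 - 2 * r) * (3 - 2 * p)) *
            ((n : ℝ) ^ ((1 - 4 * r) / 2) * L ^ ((1 : ℝ) / 2) * t) ^ (2 * (p - 1))) := by ring
      _ = _ := by rw [e1, e2]; ring
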